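/- arXiv:2403.18130 — 2 statements merged into one kernel-verified Lean document; each statement's English description precedes it below -/
import Mathlib

section
/- For n ≥ 1 and 1 < q < 1 + 2/(n+1), the function x ↦ x·p_q(x) from ℝⁿ to ℝⁿ is Lebesgue integrable and ∫_{ℝⁿ} x·p_q(x) dx = μ_q; i.e., the mean of the multivariate q-Gaussian equals its q-mean μ_q. -/
open MeasureTheory Matrix

/-- Normalization constant of the multivariate q-Gaussian:
`Z_q = ((n+2-nq)/(q-1))^(n/2)·(det Σ_q)^(1/2)·π^(n/2)·Γ(1/(q-1) - n/2)/Γ(1/(q-1))`. -/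
noncomputable def Zq (n : ℕ) (q : ℝ) (S : Matrix (Fin n) (Fin n) ℝ) : ℝ :=
  (((n : ℝ) + 2 - n * q) / (q - 1)) ^ ((n : ℝ) / 2) * S.det ^ ((1 : ℝ) / 2) *
    Real.pi ^ ((n : ℝ) / 2) * Real.Gamma (1 / (q - 1) - (n : ℝ) / 2) / Real.Gamma (1 / (q - 1))

/-- The multivariate q-Gaussian density
`p_q(x) = (1/Z_q)·[1 + ((q-1)/(n+2-nq))·(x-μ_q)ᵀΣ_q⁻¹(x-μ_q)]^(-1/(q-1))`. -/
noncomputable def pq (n : ℕ) (q : ℝ) (μq : Fin n → ℝ) (S : Matrix (Fin n) (Fin n) ℝ)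
    (x : Fin n → ℝ) : ℝ :=
  (1 / Zq n q S) *
    (1 + ((q - 1) / ((n : ℝ) + 2 - n * q)) *
      ((x - μq) ⬝ᵥ S⁻¹.mulVec (x - μq))) ^ (-(1 / (q - 1)))

open Real in
lemma aux_norm_sq_le {n : ℕ} (z : Fin n → ℝ) : ‖z‖ ^ 2 ≤ z ⬝ᵥ z := by
  have h0 : 0 ≤ z ⬝ᵥ z := by
    simp only [dotProduct]; exact Finset.sum_nonneg fun i _ => mul_self_nonneg _
  have : ‖z‖ ≤ √(z ⬝ᵥ z) := by
    refine (pi_norm_le_iff_of_nonneg (Real.sqrt_nonneg _)).2 fun i => ?_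
    apply Real.abs_le_sqrt
    rw [sq]
    simp only [dotProduct]
    exact Finset.single_le_sum (f := fun i => z i * z i) (fun i _ => mul_self_nonneg _)
      (Finset.mem_univ i)
  calc ‖z‖ ^ 2 ≤ √(z ⬝ᵥ z) ^ 2 := by gcongr
    _ = _ := Real.sq_sqrt h0

lemma aux_nonneg {n : ℕ} (z : Fin n → ℝ) : 0 ≤ z ⬝ᵥ z :=
  (sq_nonneg _).trans (aux_norm_sq_le z)

lemma aux_cont {n : ℕ} (b : ℝ) :
    Continuous (fun z : Fin n → ℝ => (1 + z ⬝ᵥ z) ^ (-b)) := by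
  refine Continuous.rpow_const ?_ fun z => Or.inl ?_
  · simp only [dotProduct]; fun_prop
  · have := aux_nonneg z; positivity

lemma aux_int {n : ℕ} {b : ℝ} (hb : (n : ℝ) < 2 * b) :
    Integrable (fun z : Fin n → ℝ => (1 + z ⬝ᵥ z) ^ (-b)) := by
  have h := integrable_rpow_neg_one_add_norm_sq (E := Fin n → ℝ) (μ := volume) (r := 2 * b)
    (by simpa using hb)
  refine h.mono' (aux_cont b).aestronglyMeasurable (Filter.Eventually.of_forall fun z => ?_)
  have h1 := aux_norm_sq_le z
  have h2 := aux_nonneg z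
  rw [Real.norm_of_nonneg (by positivity), show -(2 * b) / 2 = -b by ring]
  have : 0 ≤ b := by have : (0:ℝ) ≤ n := n.cast_nonneg
                     linarith
  exact Real.rpow_le_rpow_of_nonpos (by positivity) (by linarith) (by linarith)

lemma aux_int_smul {n : ℕ} {b : ℝ} (hb : (n : ℝ) + 1 < 2 * b) :
    Integrable (fun z : Fin n → ℝ => (1 + z ⬝ᵥ z) ^ (-b) • z) := by
  have h := aux_int (n := n) (b := b - 1 / 2) (by linarith)
  refine h.mono' ((aux_cont b).smul continuous_id).aestronglyMeasurable
    (Filter.Eventually.of_forall fun z => ?_)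
  have h1 := aux_norm_sq_le z
  have h2 := aux_nonneg z
  rw [norm_smul, Real.norm_of_nonneg (by positivity), show -(b - 1 / 2) = -b + 1 / 2 by ring,
    Real.rpow_add (by positivity), ← Real.sqrt_eq_rpow]
  gcongr
  exact Real.le_sqrt_of_sq_le (by linarith)

lemma aux_gauss {n : ℕ} {t : ℝ} (ht : 0 < t) :
    ∫ z : Fin n → ℝ, Real.exp (-t * (z ⬝ᵥ z)) = Real.pi ^ ((n : ℝ) / 2) * t ^ (-((n : ℝ) / 2)) := by
  have h : ∀ z : Fin n → ℝ, Real.exp (-t * (z ⬝ᵥ z)) = ∏ i, Real.exp (-t * (z i) ^ 2) := by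
    intro z
    rw [← Real.exp_sum, dotProduct, Finset.mul_sum]
    simp only [sq]
  simp_rw [h]
  rw [integral_fintype_prod_volume_eq_pow (fun x : ℝ => Real.exp (-t * x ^ 2)), integral_gaussian,
    Fintype.card_fin, Real.sqrt_eq_rpow, ← Real.rpow_natCast, ← Real.rpow_mul (by positivity),
    Real.div_rpow Real.pi_pos.le ht.le, Real.rpow_neg ht.le, div_eq_mul_inv]
  congr 2 <;> ring_nf

lemma aux_norm {n : ℕ} {a : ℝ} (ha : (n : ℝ) < 2 * a) :
    ∫ z : Fin n → ℝ, (1 + z ⬝ᵥ z) ^ (-a) =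
      Real.pi ^ ((n : ℝ) / 2) * Real.Gamma (a - (n : ℝ) / 2) / Real.Gamma a := by
  have ha0 : 0 < a := by
    have : (0:ℝ) ≤ n := n.cast_nonneg
    linarith
  have hG := Real.Gamma_pos_of_pos ha0
  let F : (Fin n → ℝ) → ℝ → ℝ := fun z t => t ^ (a - 1) * Real.exp (-((1 + z ⬝ᵥ z) * t))
  have hF : ∀ z, ∫ t in Set.Ioi (0:ℝ), F z t = (1 + z ⬝ᵥ z) ^ (-a) * Real.Gamma a := by
    intro z
    have h2 := aux_nonneg z
    have hp : 0 < 1 + z ⬝ᵥ z := by positivity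
    rw [Real.integral_rpow_mul_exp_neg_mul_Ioi ha0 hp, one_div, Real.inv_rpow hp.le,
      Real.rpow_neg hp.le]
  have hmeas : AEStronglyMeasurable (Function.uncurry F)
      (volume.prod (volume.restrict (Set.Ioi (0:ℝ)))) := by
    apply Measurable.aestronglyMeasurable
    simp only [F, Function.uncurry_def, dotProduct]
    fun_prop
  have hint : Integrable (Function.uncurry F)
      (volume.prod (volume.restrict (Set.Ioi (0:ℝ)))) := by
    rw [integrable_prod_iff hmeas]
    constructor
    · refine Filter.Eventually.of_forall fun z => ?_
      have h2 := aux_nonneg z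
      have := integrableOn_rpow_mul_exp_neg_mul_rpow (p := 1) (s := a - 1) (b := 1 + z ⬝ᵥ z)
        (by linarith) one_pos (by positivity)
      simp only [Real.rpow_one, neg_mul] at this
      exact this
    · refine ((aux_int ha).mul_const (Real.Gamma a)).congr (Filter.Eventually.of_forall fun z => ?_)
      simp only
      rw [← hF]
      refine setIntegral_congr_fun measurableSet_Ioi fun t ht => ?_
      have : 0 < t := ht
      simp only [Function.uncurry]
      rw [Real.norm_of_nonneg]
      simp only [F]; positivity
  have hswap := integral_integral_swap hint
  simp_rw [hF] at hswap
  rw [integral_mul_const] at hswap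
  rw [eq_div_iff hG.ne', hswap]
  have : ∀ t ∈ Set.Ioi (0:ℝ), ∫ z, F z t =
      Real.pi ^ ((n : ℝ) / 2) * (Real.exp (-t) * t ^ (a - (n : ℝ) / 2 - 1)) := by
    intro t ht
    have ht : 0 < t := ht
    have h : ∀ z, F z t = (t ^ (a - 1) * Real.exp (-t)) * Real.exp (-t * (z ⬝ᵥ z)) := by
      intro z
      simp only [F]
      rw [mul_assoc, ← Real.exp_add]; ring_nf
    simp_rw [h]
    rw [integral_const_mul, aux_gauss ht, show a - (n : ℝ) / 2 - 1 = (a - 1) + -((n:ℝ)/2) by ring,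
      Real.rpow_add ht]
    ring
  rw [setIntegral_congr_fun measurableSet_Ioi this, integral_const_mul,
    ← Real.Gamma_eq_integral (by linarith)]

lemma aux_odd {n : ℕ} (b : ℝ) :
    ∫ z : Fin n → ℝ, (1 + z ⬝ᵥ z) ^ (-b) • z = 0 := by
  have h := integral_neg_eq_self (fun z : Fin n → ℝ => (1 + z ⬝ᵥ z) ^ (-b) • z) volume
  simp only [neg_dotProduct_neg, smul_neg, integral_neg] at h
  exact self_eq_neg.1 h.symm

open scoped MatrixOrder in
lemma aux_sqrt {n : ℕ} {S : Matrix (Fin n) (Fin n) ℝ} (hpos : S.PosDef) :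
    ∃ X : Matrix (Fin n) (Fin n) ℝ, Xᵀ = X ∧ X * X = S := by
  have hA : (0 : Matrix (Fin n) (Fin n) ℝ) ≤ S := hpos.posSemidef.nonneg
  obtain ⟨X, hX, -, h⟩ := CFC.exists_sqrt_of_isSelfAdjoint_of_quasispectrumRestricts
    hpos.isHermitian (QuasispectrumRestricts.nnreal_of_nonneg hA)
  exact ⟨X, by simpa [IsSelfAdjoint, star_eq_conjTranspose, conjTranspose_eq_transpose_of_trivial] using hX, h⟩

/-- For `n ≥ 1` and `1 < q < 1 + 2/(n+1)`, `x ↦ x·p_q(x)` is Lebesgue integrable on `ℝⁿ`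
and `∫ x·p_q(x) dx = μ_q`: the mean of the multivariate q-Gaussian equals its q-mean. -/
theorem qGaussian_multivariate_mean (n : ℕ) (hn : 1 ≤ n) (q : ℝ)
    (hq1 : 1 < q) (hq2 : q < 1 + 2 / ((n : ℝ) + 1)) (μq : Fin n → ℝ)
    (S : Matrix (Fin n) (Fin n) ℝ) (hsymm : S.IsSymm) (hpos : S.PosDef) :
    Integrable (fun x : Fin n → ℝ => pq n q μq S x • x) ∧
    (∫ x : Fin n → ℝ, pq n q μq S x • x) = μq := by
  have hn0 : (0:ℝ) ≤ n := n.cast_nonneg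
  have hq : 0 < q - 1 := by linarith
  have hq3 : (q - 1) * (n + 1) < 2 := by
    have : q - 1 < 2 / ((n:ℝ) + 1) := by linarith
    rwa [lt_div_iff₀ (by positivity)] at this
  have hd : 0 < (n:ℝ) + 2 - n * q := by nlinarith
  set a : ℝ := 1 / (q - 1) with ha_def
  have ha : (n:ℝ) + 1 < 2 * a := by
    rw [ha_def, mul_one_div, lt_div_iff₀ hq]; linarith
  have ha' : (n:ℝ) < 2 * a := by linarith
  obtain ⟨X, hXt, hXX⟩ := aux_sqrt hpos
  have hdetS : 0 < S.det := hpos.det_pos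
  have hdetX2 : X.det * X.det = S.det := by rw [← det_mul, hXX]
  have hdetX : X.det ≠ 0 := by
    intro h; rw [h] at hdetX2; simp at hdetX2; linarith
  set e : ℝ := ((n:ℝ) + 2 - n * q) / (q - 1) with he_def
  have he : 0 < e := div_pos hd hq
  set k : ℝ := √e with hk_def
  have hk : 0 < k := Real.sqrt_pos.2 he
  set M : Matrix (Fin n) (Fin n) ℝ := k • X with hM_def
  have hdetM : M.det = k ^ n * X.det := by rw [hM_def, det_smul, Fintype.card_fin]
  have hdetM0 : M.det ≠ 0 := by rw [hdetM]; positivity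
  have habs : |M.det| = e ^ ((n:ℝ) / 2) * S.det ^ ((1:ℝ) / 2) := by
    rw [hdetM, abs_mul, abs_of_pos (by positivity : 0 < k ^ n), ← hdetX2, ← Real.sqrt_eq_rpow,
      Real.sqrt_mul_self_eq_abs, hk_def, Real.sqrt_eq_rpow, ← Real.rpow_natCast,
      ← Real.rpow_mul he.le]
    congr 2; ring
  set I : ℝ := ∫ z : Fin n → ℝ, (1 + z ⬝ᵥ z) ^ (-a) with hI_def
  have hI := aux_norm ha'
  rw [← hI_def] at hI
  have hIpos : 0 < I := by
    rw [hI]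
    have h1 := Real.Gamma_pos_of_pos (show 0 < a - (n:ℝ)/2 by linarith)
    have h2 := Real.Gamma_pos_of_pos (show 0 < a by linarith)
    have := Real.pi_pos
    positivity
  have hZ : Zq n q S = |M.det| * I := by
    rw [hI, habs, Zq]; ring
  have hquad : ∀ z : Fin n → ℝ, (M *ᵥ z) ⬝ᵥ (S⁻¹ *ᵥ (M *ᵥ z)) = e * (z ⬝ᵥ z) := by
    intro z
    have hu : IsUnit X.det := hdetX.isUnit
    have h1 : S⁻¹ * X = X⁻¹ := by
      rw [← hXX, Matrix.mul_inv_rev, Matrix.mul_assoc, Matrix.nonsing_inv_mul _ hu, Matrix.mul_one]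
    have h2 : (X *ᵥ z) ⬝ᵥ (S⁻¹ *ᵥ (X *ᵥ z)) = z ⬝ᵥ z := by
      rw [mulVec_mulVec, h1]
      nth_rewrite 1 [← hXt]
      rw [mulVec_transpose, ← dotProduct_mulVec, mulVec_mulVec, Matrix.mul_nonsing_inv _ hu,
        one_mulVec]
    rw [hM_def, smul_mulVec, mulVec_smul, smul_dotProduct, dotProduct_smul, h2, smul_eq_mul,
      smul_eq_mul, ← mul_assoc, hk_def, Real.mul_self_sqrt he.le]
  let φ : (Fin n → ℝ) → (Fin n → ℝ) := fun y => pq n q μq S (y + μq) • (y + μq)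
  have hφ : ∀ z, φ (toLin' M z) = (1 / Zq n q S) • (M.toLin' ((1 + z ⬝ᵥ z) ^ (-a) • z) +
      (1 + z ⬝ᵥ z) ^ (-a) • μq) := by
    intro z
    have hce : (q - 1) / ((n:ℝ) + 2 - n * q) * e = 1 := by
      rw [he_def, div_mul_div_comm, mul_comm]; exact div_self (mul_pos hd hq).ne'
    simp only [φ, pq, toLin'_apply, add_sub_cancel_right]
    rw [hquad, ← mul_assoc, hce, one_mul, mulVec_smul, ← smul_add, smul_smul]
  have hL := (LinearMap.toContinuousLinearMap M.toLin').integrable_comp (aux_int_smul ha)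
  have hLi := (LinearMap.toContinuousLinearMap M.toLin').integral_comp_comm (aux_int_smul ha)
  simp only [LinearMap.coe_toContinuousLinearMap'] at hL hLi
  rw [aux_odd, map_zero] at hLi
  have hR : Integrable (fun z : Fin n → ℝ => (1 + z ⬝ᵥ z) ^ (-a) • μq) :=
    (aux_int ha').smul_const μq
  have hemb : MeasurableEmbedding (toLin' M) := by
    have hinj : Function.Injective (toLin' M) := by
      exact mulVec_injective_of_isUnit ((Matrix.isUnit_iff_isUnit_det M).2 hdetM0.isUnit)
    exact ((toLin' M).continuous_of_finiteDimensional).measurableEmbedding hinj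
  have hmap := Real.map_matrix_volume_pi_eq_smul_volume_pi hdetM0
  have hc0 : ENNReal.ofReal |M.det⁻¹| ≠ 0 := by simpa using hdetM0
  have hφint0 : Integrable (fun z => φ (toLin' M z)) := by
    simp_rw [hφ]
    exact (Integrable.add hL hR).smul (1 / Zq n q S)
  have hφint : Integrable φ := by
    have : Integrable φ (Measure.map (toLin' M) volume) := (hemb.integrable_map_iff).2 hφint0
    rw [hmap] at this
    exact (integrable_smul_measure hc0 ENNReal.ofReal_ne_top).1 this
  have hφval : ∫ y, φ y = μq := by
    have h1 := hemb.integral_map (μ := volume) φ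
    rw [hmap, integral_smul_measure] at h1
    simp_rw [hφ] at h1
    rw [integral_smul, integral_add hL hR, hLi, integral_smul_const, ← hI_def, zero_add, hZ,
      ENNReal.toReal_ofReal (abs_nonneg _), abs_inv] at h1
    have habs0 : |M.det| ≠ 0 := abs_ne_zero.2 hdetM0
    have h2 := congrArg (fun v => |M.det| • v) h1
    simp only [smul_smul] at h2
    rw [mul_inv_cancel₀ habs0, one_smul] at h2
    rw [h2, show |M.det| * (1 / (|M.det| * I) * I) = 1 by field_simp, one_smul]
  constructor
  · have := hφint.comp_sub_right μq
    simpa only [φ, sub_add_cancel] using this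
  · exact (integral_add_right_eq_self (fun x => pq n q μq S x • x) μq).symm.trans hφval
end

section
/- For n ≥ 1 and 1 < q < 1 + 2/(n+2), the matrix-valued function x ↦ (x-μ_q)(x-μ_q)ᵀ·p_q(x) is Lebesgue integrable on ℝⁿ and ∫_{ℝⁿ} (x-μ_q)(x-μ_q)ᵀ·p_q(x) dx = ((n+2-nq)/(n+4-(n+2)q))·Σ_q; i.e., the (ordinary) covariance of the multivariate q-Gaussian exists, is finite, and equals the q-covariance Σ_q scaled by the positive factor (n+2-nq)/(n+4-(n+2)q). -/
open MeasureTheory Matrix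

lemma qg_int1 {b : ℝ} (hb : 0 < b) (e : ℕ) :
    Integrable (fun x : ℝ => x ^ e * Real.exp (-b * x ^ 2)) := by
  have := integrable_rpow_mul_exp_neg_mul_sq hb (s := (e:ℝ)) (by have : (0:ℝ) ≤ e := by positivity
                                                                 linarith)
  simpa using this

lemma qg_mom1 (b : ℝ) : ∫ x : ℝ, x * Real.exp (-b * x ^ 2) = 0 := by
  have h := integral_neg_eq_self (fun x : ℝ => x * Real.exp (-b * x ^ 2)) volume
  simp only [neg_sq, neg_mul, integral_neg] at h ⊢
  linarith

lemma qg_mom2 {b : ℝ} (hb : 0 < b) :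
    ∫ x : ℝ, x ^ 2 * Real.exp (-b * x ^ 2) = √(Real.pi / b) / (2 * b) := by
  have h := integral_comp_abs (f := fun x : ℝ => x ^ 2 * Real.exp (-b * x ^ 2))
  simp only [sq_abs] at h
  rw [h]
  have h2 := integral_rpow_mul_exp_neg_mul_rpow (p := 2) (q := 2) (b := b) (by norm_num) (by norm_num) hb
  simp only [Real.rpow_two] at h2
  rw [h2]
  have : ((2:ℝ) + 1) / 2 = 1/2 + 1 := by norm_num
  rw [neg_div, this, Real.Gamma_add_one (by norm_num), Real.Gamma_one_half_eq, neg_add,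
    Real.rpow_add hb, Real.rpow_neg_one, Real.rpow_neg hb.le, ← Real.sqrt_eq_rpow, Real.sqrt_div Real.pi_pos.le]
  field_simp

lemma qg_prod {n : ℕ} (b : ℝ) (k l : Fin n) (y : Fin n → ℝ) :
    y k * y l * Real.exp (-b * (y ⬝ᵥ y)) =
      ∏ m, (y m ^ ((if m = k then 1 else 0) + (if m = l then 1 else 0)) * Real.exp (-b * y m ^ 2)) := by
  rw [Finset.prod_mul_distrib, ← Real.exp_sum]
  congr 1
  · simp_rw [pow_add]
    rw [Finset.prod_mul_distrib]
    simp only [pow_ite, pow_one, pow_zero, Finset.prod_ite_eq', Finset.mem_univ, if_true]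
  · simp [dotProduct, Finset.mul_sum, sq]

lemma qg_gint {n : ℕ} {b : ℝ} (hb : 0 < b) (k l : Fin n) :
    Integrable (fun y : Fin n → ℝ => y k * y l * Real.exp (-b * (y ⬝ᵥ y))) := by
  simp_rw [qg_prod]
  exact Integrable.fintype_prod (f := fun (m : Fin n) (x : ℝ) => x ^ ((if m = k then 1 else 0) + (if m = l then 1 else 0)) * Real.exp (-b * x ^ 2)) (fun m => qg_int1 hb _)

lemma qg_gval {n : ℕ} {b : ℝ} (hb : 0 < b) (k l : Fin n) :
    ∫ y : Fin n → ℝ, y k * y l * Real.exp (-b * (y ⬝ᵥ y)) =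
      (if k = l then 1 else 0) * ((Real.pi / b) ^ ((n : ℝ) / 2) / (2 * b)) := by
  simp_rw [qg_prod]
  rw [integral_fintype_prod_volume_eq_prod (fun (m : Fin n) (x : ℝ) => x ^ ((if m = k then 1 else 0) + (if m = l then 1 else 0)) * Real.exp (-b * x ^ 2))]
  split_ifs with h
  · subst h
    have : ∀ m : Fin n, (∫ x : ℝ, x ^ ((if m = k then 1 else 0) + (if m = k then 1 else 0)) * Real.exp (-b * x ^ 2)) = √(Real.pi / b) * (if m = k then 1 / (2 * b) else 1) := by
      intro m
      split_ifs
      · rw [qg_mom2 hb]; ring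
      · simp [← integral_gaussian]
    simp_rw [this]
    rw [Finset.prod_mul_distrib]
    simp only [Finset.prod_const, Finset.card_univ, Fintype.card_fin, Finset.prod_ite_eq', Finset.mem_univ, if_true]
    rw [Real.sqrt_eq_rpow, ← Real.rpow_mul_natCast (by positivity)]
    rw [show (1:ℝ)/2 * n = n/2 by ring]
    ring
  · rw [zero_mul]
    apply Finset.prod_eq_zero (Finset.mem_univ k)
    simpa [h] using qg_mom1 b

/-- the Fubini integrand -/
noncomputable def qgF {n : ℕ} (a c : ℝ) (k l : Fin n) (y : Fin n → ℝ) (t : ℝ) : ℝ :=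
  (t ^ (a - 1) * Real.exp (-t)) * (y k * y l * Real.exp (-(t * c) * (y ⬝ᵥ y)))

lemma qgF_y {n : ℕ} {a c : ℝ} (hc : 0 < c) (k l : Fin n) {t : ℝ} (ht : 0 < t) :
    ∫ y, qgF a c k l y t = (if k = l then 1 else 0) *
      ((Real.pi / c) ^ ((n : ℝ) / 2) / (2 * c)) * (Real.exp (-t) * t ^ ((a - n / 2 - 1) - 1)) := by
  unfold qgF
  rw [integral_const_mul, qg_gval (by positivity)]
  have e1 : (Real.pi / (t * c)) ^ ((n : ℝ) / 2) = (Real.pi / c) ^ ((n : ℝ) / 2) * (t ^ ((n:ℝ)/2))⁻¹ := by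
    rw [← Real.inv_rpow ht.le, ← Real.mul_rpow (by positivity) (by positivity)]
    congr 1; field_simp
  have e2 : t ^ ((a - n / 2 - 1) - 1) = t ^ (a - 1) * (t ^ ((n:ℝ)/2))⁻¹ * t⁻¹ := by
    rw [← Real.rpow_neg ht.le, ← Real.rpow_neg_one, ← Real.rpow_add ht, ← Real.rpow_add ht]
    congr 1; ring
  rw [e1, e2]
  field_simp

lemma qgF_t {n : ℕ} {a c : ℝ} (hc : 0 < c) (ha : 0 < a) (k l : Fin n) (y : Fin n → ℝ) :
    ∫ t in Set.Ioi 0, qgF a c k l y t = y k * y l * (1 + c * (y ⬝ᵥ y)) ^ (-a) * Real.Gamma a := by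
  have h0 : 0 ≤ y ⬝ᵥ y := by simpa using dotProduct_star_self_nonneg y
  have h1 : 0 < 1 + c * (y ⬝ᵥ y) := by positivity
  have h := Real.integral_rpow_mul_exp_neg_mul_Ioi ha h1
  rw [one_div, Real.inv_rpow h1.le, ← Real.rpow_neg h1.le] at h
  rw [mul_assoc, ← h, ← integral_const_mul]
  congr 1; ext t
  unfold qgF
  rw [show -((1 + c * (y ⬝ᵥ y)) * t) = -t + -(t * c) * (y ⬝ᵥ y) by ring, Real.exp_add]
  ring

lemma qgF_int {n : ℕ} {a c : ℝ} (hc : 0 < c) (ha : 0 < a - n / 2 - 1) (k l : Fin n) :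
    Integrable (Function.uncurry (qgF a c k l)) (volume.prod (volume.restrict (Set.Ioi 0))) := by
  have hm : ∀ k l : Fin n, Measurable (Function.uncurry (qgF a c k l)) := by
    intro k l
    unfold qgF Function.uncurry dotProduct
    fun_prop
  have hpos : ∀ᵐ t ∂(volume.restrict (Set.Ioi (0:ℝ))), 0 < t := ae_restrict_mem measurableSet_Ioi
  have diag : ∀ k : Fin n, Integrable (Function.uncurry (qgF a c k k)) (volume.prod (volume.restrict (Set.Ioi 0))) := by
    intro k
    rw [integrable_prod_iff' (hm k k).aestronglyMeasurable]
    constructor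
    · filter_upwards [hpos] with t ht
      have := (qg_gint (b := t * c) (by positivity) k k).const_mul (t ^ (a - 1) * Real.exp (-t))
      simpa only [Function.uncurry, qgF] using this
    · have := (Real.GammaIntegral_convergent ha).const_mul ((Real.pi / c) ^ ((n : ℝ) / 2) / (2 * c))
      refine this.congr ?_
      filter_upwards [hpos] with t ht
      have := qgF_y (a := a) hc k k ht
      simp only [if_true, one_mul] at this
      rw [← this]
      congr 1; ext y
      rw [Real.norm_of_nonneg]; · rfl
      simp only [Function.uncurry, qgF]
      have := mul_self_nonneg (y k)
      positivity
  refine ((diag k).add (diag l)).mono' (hm k l).aestronglyMeasurable ?_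
  have : ∀ᵐ z ∂((volume : Measure (Fin n → ℝ)).prod (volume.restrict (Set.Ioi (0:ℝ)))), 0 < z.2 :=
    Measure.quasiMeasurePreserving_snd.ae hpos
  filter_upwards [this] with z hz
  simp only [Function.uncurry, qgF, Pi.add_apply]
  rw [← mul_add, ← add_mul, norm_mul, norm_mul (z.1 k * z.1 l), Real.norm_of_nonneg (by positivity), Real.norm_of_nonneg (Real.exp_nonneg _)]
  gcongr
  rw [norm_mul, Real.norm_eq_abs, Real.norm_eq_abs, ← abs_mul_abs_self (z.1 k), ← abs_mul_abs_self (z.1 l)]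
  nlinarith [sq_nonneg (|z.1 k| - |z.1 l|), sq_nonneg (|z.1 k| + |z.1 l|)]

lemma qg_std {n : ℕ} {a c : ℝ} (hc : 0 < c) (ha : 0 < a - n / 2 - 1) (k l : Fin n) :
    Integrable (fun y : Fin n → ℝ => y k * y l * (1 + c * (y ⬝ᵥ y)) ^ (-a)) ∧
    ∫ y : Fin n → ℝ, y k * y l * (1 + c * (y ⬝ᵥ y)) ^ (-a) = (if k = l then 1 else 0) *
      (((Real.pi / c) ^ ((n : ℝ) / 2) / (2 * c)) * Real.Gamma (a - n / 2 - 1) / Real.Gamma a) := by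
  have ha0 : 0 < a := by have : (0:ℝ) ≤ n := by positivity
                         linarith
  have hG := Real.Gamma_pos_of_pos ha0
  have hI := qgF_int hc ha k l
  have h1 := hI.integral_prod_left
  have h2 := integral_integral_swap hI
  simp only [Function.uncurry] at h1
  simp_rw [qgF_t hc ha0] at h1 h2
  constructor
  · refine (h1.mul_const (Real.Gamma a)⁻¹).congr (Filter.Eventually.of_forall fun y => ?_)
    simp only
    field_simp
  · rw [integral_mul_const, setIntegral_congr_fun measurableSet_Ioi (fun t ht => qgF_y hc k l ht),
      integral_const_mul, ← Real.Gamma_eq_integral ha] at h2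
    rw [eq_div_of_mul_eq hG.ne' h2]
    ring

lemma qg_sqrt {n : ℕ} {S : Matrix (Fin n) (Fin n) ℝ} (hpos : S.PosDef) :
    ∃ A : Matrix (Fin n) (Fin n) ℝ, S = A * Aᵀ := by
  open scoped MatrixOrder in
  obtain ⟨B, hB⟩ := CStarAlgebra.nonneg_iff_eq_star_mul_self.mp hpos.posSemidef.nonneg
  exact ⟨Bᵀ, by rw [hB, Matrix.star_eq_conjTranspose, Matrix.conjTranspose_eq_transpose_of_trivial,
    Matrix.transpose_transpose]⟩

lemma qg_lin {n : ℕ} {a c : ℝ} (hc : 0 < c) (ha : 0 < a - n / 2 - 1)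
    {S : Matrix (Fin n) (Fin n) ℝ} (hpos : S.PosDef) (i j : Fin n) :
    Integrable (fun u : Fin n → ℝ => u i * u j * (1 + c * (u ⬝ᵥ S⁻¹ *ᵥ u)) ^ (-a)) ∧
    ∫ u : Fin n → ℝ, u i * u j * (1 + c * (u ⬝ᵥ S⁻¹ *ᵥ u)) ^ (-a) = S.det ^ ((1:ℝ)/2) *
      (((Real.pi / c) ^ ((n : ℝ) / 2) / (2 * c)) * Real.Gamma (a - n / 2 - 1) / Real.Gamma a) * S i j := by
  obtain ⟨A, hA⟩ := qg_sqrt hpos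
  have hdS : S.det = A.det ^ 2 := by rw [hA, det_mul, det_transpose, sq]
  have hdp := hpos.det_pos
  have hdA : A.det ≠ 0 := by
    intro h; rw [hdS, h] at hdp; simp at hdp
  have hsd : S.det ^ ((1:ℝ)/2) = |A.det| := by
    rw [hdS, ← Real.sqrt_eq_rpow, Real.sqrt_sq_eq_abs]
  have hU : IsUnit A.det := isUnit_iff_ne_zero.mpr hdA
  have hUt : IsUnit Aᵀ.det := by rwa [det_transpose]
  have hq : ∀ y : Fin n → ℝ, (A *ᵥ y) ⬝ᵥ S⁻¹ *ᵥ (A *ᵥ y) = y ⬝ᵥ y := by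
    intro y
    have h1 : Aᵀ * (S⁻¹ * A) = 1 := by
      rw [hA, Matrix.mul_inv_rev, Matrix.mul_assoc, Matrix.nonsing_inv_mul _ hU, Matrix.mul_one,
        Matrix.mul_nonsing_inv _ hUt]
    rw [Matrix.mulVec_mulVec, ← Matrix.vecMul_transpose, ← Matrix.dotProduct_mulVec,
      Matrix.mulVec_mulVec, h1, Matrix.one_mulVec]
  set g : (Fin n → ℝ) → ℝ := fun u => u i * u j * (1 + c * (u ⬝ᵥ S⁻¹ *ᵥ u)) ^ (-a) with hg
  have hgm : Measurable g := by
    rw [hg]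
    unfold mulVec dotProduct
    fun_prop
  have hLm : Measurable (toLin' A) := (LinearMap.continuous_on_pi _).measurable
  have hcomp : ∀ y, g (toLin' A y) =
      ∑ k, ∑ l, A i k * A j l * (y k * y l * (1 + c * (y ⬝ᵥ y)) ^ (-a)) := by
    intro y
    simp only [hg, toLin'_apply, hq]
    simp only [mulVec, dotProduct]
    rw [Finset.sum_mul_sum, Finset.sum_mul]
    refine Finset.sum_congr rfl fun k _ => ?_
    rw [Finset.sum_mul]
    refine Finset.sum_congr rfl fun l _ => ?_
    ring
  have hI : Integrable (fun y => g (toLin' A y)) := by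
    simp_rw [hcomp]
    exact integrable_finsetSum _ fun k _ => integrable_finsetSum _ fun l _ =>
      (qg_std hc ha k l).1.const_mul _
  have hV : ∫ y, g (toLin' A y) = 
      (((Real.pi / c) ^ ((n : ℝ) / 2) / (2 * c)) * Real.Gamma (a - n / 2 - 1) / Real.Gamma a) * S i j := by
    simp_rw [hcomp]
    rw [integral_finsetSum _ fun k _ => integrable_finsetSum _ fun l _ =>
      (qg_std hc ha k l).1.const_mul _]
    simp_rw [integral_finsetSum _ fun l _ => (qg_std hc ha _ l).1.const_mul _, integral_const_mul,
      (qg_std hc ha _ _).2]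
    simp only [ite_mul, one_mul, zero_mul, mul_ite, mul_zero, Finset.sum_ite_eq, Finset.mem_univ, if_true]
    rw [← Finset.sum_mul, hA, Matrix.mul_apply, mul_comm]
    rfl
  have hmap := Real.map_matrix_volume_pi_eq_smul_volume_pi hdA
  have hne : ENNReal.ofReal |A.det⁻¹| ≠ 0 := by simp [hdA]
  constructor
  · have := (integrable_map_measure hgm.aestronglyMeasurable hLm.aemeasurable).2 hI
    rw [hmap] at this
    exact (integrable_smul_measure hne ENNReal.ofReal_ne_top).1 this
  · have := integral_map (μ := volume) hLm.aemeasurable (f := g) hgm.aestronglyMeasurable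
    rw [hmap, integral_smul_measure, hV, ENNReal.toReal_ofReal (abs_nonneg _), abs_inv, smul_eq_mul] at this
    have h3 : |A.det| ≠ 0 := abs_ne_zero.mpr hdA
    rw [hsd, mul_assoc, ← this]
    field_simp

theorem qGaussian_multivariate_covariance (n : ℕ) (hn : 1 ≤ n) (q : ℝ)
    (hq1 : 1 < q) (hq2 : q < 1 + 2 / ((n : ℝ) + 2)) (μq : Fin n → ℝ)
    (S : Matrix (Fin n) (Fin n) ℝ) (hsymm : S.IsSymm) (hpos : S.PosDef) :
    ∀ i j : Fin n,
      Integrable (fun x : Fin n → ℝ => (x i - μq i) * (x j - μq j) * pq n q μq S x) ∧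
      (∫ x : Fin n → ℝ, (x i - μq i) * (x j - μq j) * pq n q μq S x) =
        (((n : ℝ) + 2 - n * q) / ((n : ℝ) + 4 - ((n : ℝ) + 2) * q)) * S i j := by
  intro i j
  have hn0 : (0:ℝ) ≤ n := by positivity
  have hr : 0 < q - 1 := by linarith
  have hk : (q - 1) * ((n:ℝ) + 2) < 2 := by
    rw [← lt_div_iff₀ (by positivity)]; linarith
  have hD : 0 < (n:ℝ) + 2 - n * q := by nlinarith
  have hE : 0 < (n:ℝ) + 4 - ((n:ℝ) + 2) * q := by nlinarith
  have hc : 0 < (q - 1) / ((n:ℝ) + 2 - n * q) := by positivity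
  have hs : 1 / (q - 1) - n / 2 - 1 = ((n:ℝ) + 4 - ((n:ℝ) + 2) * q) / (2 * (q - 1)) := by
    field_simp; ring
  have ha : 0 < 1 / (q - 1) - n / 2 - 1 := by rw [hs]; positivity
  obtain ⟨h1, h2⟩ := qg_lin hc ha hpos i j
  have heq : (fun x : Fin n → ℝ => (x i - μq i) * (x j - μq j) * pq n q μq S x) =
      fun x => (1 / Zq n q S) * (fun u : Fin n → ℝ => u i * u j *
        (1 + ((q - 1) / ((n:ℝ) + 2 - n * q)) * (u ⬝ᵥ S⁻¹ *ᵥ u)) ^ (-(1 / (q - 1)))) (x - μq) := by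
    ext x
    simp only [pq, Pi.sub_apply]
    ring
  rw [heq]
  refine ⟨(h1.comp_sub_right μq).const_mul _, ?_⟩
  rw [integral_const_mul, integral_sub_right_eq_self (fun u : Fin n → ℝ => u i * u j *
        (1 + ((q - 1) / ((n:ℝ) + 2 - n * q)) * (u ⬝ᵥ S⁻¹ *ᵥ u)) ^ (-(1 / (q - 1)))) μq, h2]
  have hG1 : Real.Gamma (1 / (q - 1) - n / 2) =
      (1 / (q - 1) - n / 2 - 1) * Real.Gamma (1 / (q - 1) - n / 2 - 1) := by
    rw [← Real.Gamma_add_one ha.ne']; congr 1; ring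
  have hGp := Real.Gamma_pos_of_pos ha
  have hGa : 0 < Real.Gamma (1 / (q - 1)) := Real.Gamma_pos_of_pos (by positivity)
  have hdet : 0 < S.det ^ ((1:ℝ)/2) := Real.rpow_pos_of_pos hpos.det_pos _
  have hpi : (Real.pi / ((q - 1) / ((n:ℝ) + 2 - n * q))) ^ ((n:ℝ) / 2) =
      (((n : ℝ) + 2 - n * q) / (q - 1)) ^ ((n : ℝ) / 2) * Real.pi ^ ((n : ℝ) / 2) := by
    rw [← Real.mul_rpow (by positivity) (by positivity)]
    congr 1; field_simp
  unfold Zq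
  rw [hG1, hpi]
  have hP : 0 < (((n : ℝ) + 2 - n * q) / (q - 1)) ^ ((n : ℝ) / 2) := by positivity
  have hQ : 0 < Real.pi ^ ((n : ℝ) / 2) := by positivity
  generalize Real.Gamma (1 / (q - 1) - n / 2 - 1) = G at *
  generalize Real.Gamma (1 / (q - 1)) = G' at *
  generalize (((n : ℝ) + 2 - n * q) / (q - 1)) ^ ((n : ℝ) / 2) = P at *
  generalize Real.pi ^ ((n : ℝ) / 2) = Q at *
  generalize S.det ^ ((1:ℝ)/2) = d at *
  rw [hs]
  field_simp
end
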